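/- arXiv:1905.12430 — 6 statements merged into one kernel-verified Lean document; each statement's English description precedes it below -/
import Mathlib

section
/- Let n, d be positive integers and a, b > 0. Let X ∈ ℝ^{n×d} be a matrix whose rows satisfy ‖X_{i,·}‖₂ ≤ b for every i = 1,…,n, and set U_{a,b}(X) = {Xα : α ∈ ℝ^d, ‖α‖₂ ≤ a} ⊆ ℝ^n. Then for every ε > 0, log N(U_{a,b}(X), ε, ‖·‖_∞) ≤ (36 a² b² / ε²) · log₂(8abn/ε + 6n + 1), where ‖·‖_∞ is the maximum-absolute-coordinate norm on ℝ^n. -/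
def mUpd {n d : ℕ} (X : Fin n → Fin d → ℝ) (η : ℝ) (w : Fin d → ℝ) :
    Option (Fin n × Bool) → (Fin d → ℝ)
  | none => w
  | some (i, true) => fun j => w j + η * X i j
  | some (i, false) => fun j => w j - η * X i j

open Classical in
lemma mStep (n d : ℕ) (b ε : ℝ) (hb : 0 < b) (hε : 0 < ε)
    (X : Fin n → Fin d → ℝ) (hX : ∀ i : Fin n, ∑ j, (X i j) ^ 2 ≤ b ^ 2) (k : ℕ) :
    ∃ S : Finset (Fin d → ℝ), S.card ≤ (2 * n + 1) ^ k ∧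
      ∀ α : Fin d → ℝ, ∃ w ∈ S, (∀ i, |∑ j, X i j * (α j - w j)| ≤ ε) ∨
        ∑ j, (α j - w j) ^ 2 ≤ ∑ j, (α j) ^ 2 - k * (ε ^ 2 / b ^ 2) := by
  induction k with
  | zero => exact ⟨{0}, by simp, fun α => ⟨0, by simp, Or.inr (by simp)⟩⟩
  | succ k ih =>
    obtain ⟨S, hc, hS⟩ := ih
    refine ⟨(S ×ˢ (Finset.univ : Finset (Option (Fin n × Bool)))).image
      (fun p => mUpd X (ε / b ^ 2) p.1 p.2), ?_, ?_⟩
    · refine Finset.card_image_le.trans ?_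
      rw [Finset.card_product, pow_succ]
      apply Nat.mul_le_mul hc
      simp [mul_comm]
    · intro α
      obtain ⟨w, hw, h⟩ := hS α
      have mem : ∀ o, mUpd X (ε / b ^ 2) w o ∈
          (S ×ˢ (Finset.univ : Finset (Option (Fin n × Bool)))).image
          (fun p => mUpd X (ε / b ^ 2) p.1 p.2) := fun o =>
        Finset.mem_image.2 ⟨(w, o), by simp [hw], rfl⟩
      by_cases hg : ∀ i, |∑ j, X i j * (α j - w j)| ≤ ε
      · exact ⟨w, mem none, Or.inl hg⟩
      have h := h.resolve_left hg
      push Not at hg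
      obtain ⟨i, hi⟩ := hg
      have hηb : (ε / b ^ 2) ^ 2 * ∑ j, (X i j) ^ 2 ≤ ε ^ 2 / b ^ 2 := by
        calc _ ≤ (ε / b ^ 2) ^ 2 * b ^ 2 := by gcongr; exact hX i
          _ = _ := by field_simp
      have hη : 0 < ε / b ^ 2 := by positivity
      have he : ε ^ 2 / b ^ 2 = ε / b ^ 2 * ε := by ring
      rcases lt_abs.1 hi with hi | hi
      · refine ⟨_, mem (some (i, true)), Or.inr ?_⟩
        have e : ∑ j, (α j - mUpd X (ε / b ^ 2) w (some (i, true)) j) ^ 2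
            = ∑ j, (α j - w j) ^ 2 - 2 * (ε / b ^ 2) * ∑ j, X i j * (α j - w j)
              + (ε / b ^ 2) ^ 2 * ∑ j, (X i j) ^ 2 := by
          rw [Finset.mul_sum, Finset.mul_sum, ← Finset.sum_sub_distrib, ← Finset.sum_add_distrib]
          refine Finset.sum_congr rfl fun j _ => ?_
          simp only [mUpd]; ring
        rw [e]; push_cast
        have := mul_lt_mul_of_pos_left hi hη
        linarith
      · refine ⟨_, mem (some (i, false)), Or.inr ?_⟩
        have e : ∑ j, (α j - mUpd X (ε / b ^ 2) w (some (i, false)) j) ^ 2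
            = ∑ j, (α j - w j) ^ 2 + 2 * (ε / b ^ 2) * ∑ j, X i j * (α j - w j)
              + (ε / b ^ 2) ^ 2 * ∑ j, (X i j) ^ 2 := by
          rw [Finset.mul_sum, Finset.mul_sum, ← Finset.sum_add_distrib, ← Finset.sum_add_distrib]
          refine Finset.sum_congr rfl fun j _ => ?_
          simp only [mUpd]; ring
        rw [e]; push_cast
        have := mul_lt_mul_of_pos_left hi hη
        linarith


/-- (Maurey-type `L^∞` covering bound for linear classes, from
Zhang 2002 / "PointedoutbyYunwen", Theorem 4.)
Let `n, d` be positive integers and `a, b > 0`.  Let `X ∈ ℝ^{n×d}` have rows of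
Euclidean norm at most `b`, and let `U_{a,b}(X) = {Xα : ‖α‖₂ ≤ a}`.  Then for every
`ε > 0`,
`log N(U_{a,b}(X), ε, ‖·‖_∞) ≤ (36 a² b² / ε²) · log₂(8abn/ε + 6n + 1)`.
The covering number statement is rendered as the existence of a finite cover `C`
(in the max-coordinate norm) whose cardinality has logarithm at most the bound. -/
theorem maurey_sup_covering
    (n d : ℕ) (hn : 0 < n) (hd : 0 < d) (a b ε : ℝ)
    (ha : 0 < a) (hb : 0 < b) (hε : 0 < ε)
    (X : Fin n → Fin d → ℝ)
    (hX : ∀ i : Fin n, Real.sqrt (∑ j, (X i j) ^ 2) ≤ b) :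
    ∃ C : Finset (Fin n → ℝ),
      (∀ α : Fin d → ℝ, Real.sqrt (∑ j, (α j) ^ 2) ≤ a →
        ∃ c ∈ C, ∀ i : Fin n, |(∑ j, X i j * α j) - c i| ≤ ε) ∧
      Real.log (C.card : ℝ) ≤
        (36 * a ^ 2 * b ^ 2 / ε ^ 2) *
          Real.logb 2 (8 * a * b * n / ε + 6 * n + 1) := by
  classical
  have hX2 : ∀ i : Fin n, ∑ j, (X i j) ^ 2 ≤ b ^ 2 := fun i =>
    (Real.sqrt_le_left hb.le).1 (hX i)
  obtain ⟨S, hc, hS⟩ := mStep n d b ε hb hε X hX2 ⌊a ^ 2 * b ^ 2 / ε ^ 2⌋₊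
  have hK := Nat.floor_le (show 0 ≤ a ^ 2 * b ^ 2 / ε ^ 2 by positivity)
  have hK' := Nat.lt_floor_add_one (a ^ 2 * b ^ 2 / ε ^ 2)
  set K := ⌊a ^ 2 * b ^ 2 / ε ^ 2⌋₊
  refine ⟨S.image (fun w i => ∑ j, X i j * w j), ?_, ?_⟩
  · intro α hα
    have hα2 : ∑ j, (α j) ^ 2 ≤ a ^ 2 := (Real.sqrt_le_left ha.le).1 hα
    obtain ⟨w, hw, h⟩ := hS α
    refine ⟨_, Finset.mem_image_of_mem _ hw, ?_⟩
    intro i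
    rw [← Finset.sum_sub_distrib]
    simp only [← mul_sub]
    rcases h with h | h
    · exact h i
    · apply abs_le_of_sq_le_sq _ hε.le
      have h1 := Finset.sum_mul_sq_le_sq_mul_sq Finset.univ (X i) (fun j => α j - w j)
      have h2 : ∑ j, (α j - w j) ^ 2 ≤ ε ^ 2 / b ^ 2 := by
        have : a ^ 2 ≤ (K + 1) * (ε ^ 2 / b ^ 2) := by
          rw [div_lt_iff₀ (by positivity)] at hK'
          rw [← mul_div_assoc, le_div_iff₀ (by positivity)]
          exact hK'.le
        linarith
      calc _ ≤ _ := h1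
        _ ≤ b ^ 2 * (ε ^ 2 / b ^ 2) := by
          gcongr
          exact hX2 i
        _ = _ := by field_simp
  · have hn1 : (1 : ℝ) ≤ n := by exact_mod_cast hn
    have hp : 0 < 8 * a * b * n / ε := by positivity
    set T := 8 * a * b * n / ε + 6 * n + 1
    have hT : (2 * n + 1 : ℝ) ≤ T := by simp only [T]; linarith
    have hl : 0 ≤ Real.log T := Real.log_nonneg (by linarith)
    have hlb : Real.log T ≤ Real.logb 2 T := by
      rw [Real.logb, le_div_iff₀ (Real.log_pos (by norm_num))]
      have := Real.log_two_lt_d9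
      nlinarith
    have hA : 0 ≤ a ^ 2 * b ^ 2 / ε ^ 2 := by positivity
    have h36 : 36 * a ^ 2 * b ^ 2 / ε ^ 2 = 36 * (a ^ 2 * b ^ 2 / ε ^ 2) := by ring
    have hcard : ((S.image (fun w i => ∑ j, X i j * w j)).card : ℝ) ≤ (2 * n + 1) ^ K := by
      exact_mod_cast Finset.card_image_le.trans hc
    rcases Nat.eq_zero_or_pos (S.image (fun w i => ∑ j, X i j * w j)).card with h0 | h0
    · rw [h0]; simp only [Nat.cast_zero, Real.log_zero]
      rw [h36]
      exact mul_nonneg (by linarith) (hl.trans hlb)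
    · calc _ ≤ Real.log ((2 * n + 1) ^ K) := Real.log_le_log (by exact_mod_cast h0) hcard
        _ = K * Real.log (2 * n + 1) := Real.log_pow _ _
        _ ≤ K * Real.log T := by gcongr
        _ ≤ (36 * (a ^ 2 * b ^ 2 / ε ^ 2)) * Real.logb 2 T := by
          apply mul_le_mul _ hlb hl (by linarith)
          linarith
        _ = _ := by rw [h36]
end

section
/- Let B_β denote the ball of radius β > 0 in ℝ^d with respect to the L¹ norm. Then for every ε > 0, log N(B_β, ε, ‖·‖₂) ≤ ⌈β²/ε²⌉ · log(2d), where ‖·‖₂ is the Euclidean norm. -/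
/-- signed atoms -/
def atomL1 (d : ℕ) (β : ℝ) (p : Fin d × Bool) : Fin d → ℝ :=
  fun l => if l = p.1 then (if p.2 then β else -β) else 0

lemma atomL1_step (d : ℕ) (hd : 0 < d) (β : ℝ) (hβ : 0 < β) (v D : Fin d → ℝ)
    (hv : (∑ i, |v i|) ≤ β) :
    ∃ p, ∑ i, (D i + v i - atomL1 d β p i) ^ 2 ≤ ∑ i, (D i) ^ 2 + β ^ 2 := by
  haveI : Nonempty (Fin d) := ⟨⟨0, hd⟩⟩
  obtain ⟨m, -, hm⟩ := Finset.exists_max_image Finset.univ (fun i => |D i + v i|)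
    Finset.univ_nonempty
  have key : ∑ i, (D i + v i) * v i ≤ β * |D m + v m| := by
    calc ∑ i, (D i + v i) * v i ≤ ∑ i, |v i| * |D m + v m| := by
          apply Finset.sum_le_sum
          intro i hi
          calc (D i + v i) * v i ≤ |(D i + v i) * v i| := le_abs_self _
            _ = |v i| * |D i + v i| := by rw [abs_mul, mul_comm]
            _ ≤ _ := mul_le_mul_of_nonneg_left (hm i hi) (abs_nonneg _)
      _ = (∑ i, |v i|) * |D m + v m| := by rw [Finset.sum_mul]
      _ ≤ _ := mul_le_mul_of_nonneg_right hv (abs_nonneg _)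
  have expand : ∀ p, ∑ i, (D i + v i - atomL1 d β p i) ^ 2
      = ∑ i, (D i) ^ 2 + 2 * ∑ i, (D i + v i) * v i - ∑ i, (v i) ^ 2
        - 2 * ((D p.1 + v p.1) * (if p.2 then β else -β)) + β ^ 2 := by
    intro p
    have h1 : ∑ i, (D i + v i) * atomL1 d β p i
        = (D p.1 + v p.1) * (if p.2 then β else -β) := by
      simp [atomL1]
    have h2 : ∑ i, (atomL1 d β p i) ^ 2 = β ^ 2 := by
      rcases p with ⟨a, _ | _⟩ <;> simp [atomL1, ite_pow]
    rw [← h1, ← h2, Finset.mul_sum, Finset.mul_sum, ← Finset.sum_add_distrib,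
      ← Finset.sum_sub_distrib, ← Finset.sum_sub_distrib, ← Finset.sum_add_distrib]
    apply Finset.sum_congr rfl
    intro i _
    ring
  have hvv : 0 ≤ ∑ i, (v i) ^ 2 := Finset.sum_nonneg fun i _ => sq_nonneg _
  rcases le_total 0 (D m + v m) with h | h
  · refine ⟨(m, true), ?_⟩
    rw [expand]
    rw [abs_of_nonneg h] at key
    simp only [if_true]
    linarith
  · refine ⟨(m, false), ?_⟩
    rw [expand]
    rw [abs_of_nonpos h] at key
    simp only [Bool.false_eq_true, if_false]
    linarith

lemma atomL1_seq (d : ℕ) (hd : 0 < d) (β : ℝ) (hβ : 0 < β) (v : Fin d → ℝ)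
    (hv : (∑ i, |v i|) ≤ β) (k : ℕ) :
    ∃ f : Fin k → Fin d × Bool,
      ∑ i, (k * v i - ∑ t, atomL1 d β (f t) i) ^ 2 ≤ k * β ^ 2 := by
  induction k with
  | zero => exact ⟨Fin.elim0, by simp⟩
  | succ k ih =>
    obtain ⟨f, hf⟩ := ih
    obtain ⟨p, hp⟩ := atomL1_step d hd β hβ v
      (fun i => k * v i - ∑ t, atomL1 d β (f t) i) hv
    refine ⟨Fin.cons p f, ?_⟩
    have : ∀ i, ((k + 1 : ℕ) : ℝ) * v i
        - ∑ t, atomL1 d β ((Fin.cons p f : Fin (k + 1) → Fin d × Bool) t) i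
        = k * v i - ∑ t, atomL1 d β (f t) i + v i - atomL1 d β p i := by
      intro i
      rw [Fin.sum_univ_succ]
      simp only [Fin.cons_zero, Fin.cons_succ]
      push_cast
      ring
    simp only [this]
    push_cast
    linarith


/-- Let `B_β` be the `L¹`-ball of radius `β > 0` in `ℝ^d`.  Then for
every `ε > 0`, `log N(B_β, ε, ‖·‖₂) ≤ ⌈β²/ε²⌉ · log(2d)`, where `‖·‖₂` is the
Euclidean norm.  The covering number statement is rendered as the existence of a
finite cover `C` (in the Euclidean norm) whose cardinality has logarithm at most
the bound. -/
theorem l1_ball_l2_covering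
    (d : ℕ) (hd : 0 < d) (β ε : ℝ) (hβ : 0 < β) (hε : 0 < ε) :
    ∃ C : Finset (Fin d → ℝ),
      (∀ v : Fin d → ℝ, (∑ i, |v i|) ≤ β →
        ∃ c ∈ C, Real.sqrt (∑ i, (v i - c i) ^ 2) ≤ ε) ∧
      Real.log (C.card : ℝ) ≤ (⌈β ^ 2 / ε ^ 2⌉₊ : ℝ) * Real.log (2 * d) := by
  classical
  set k := ⌈β ^ 2 / ε ^ 2⌉₊ with hk
  have hkpos : 0 < k := Nat.ceil_pos.mpr (by positivity)
  have hkR : (0 : ℝ) < k := by exact_mod_cast hkpos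
  have hkle : β ^ 2 ≤ k * ε ^ 2 := by
    rw [← div_le_iff₀ (by positivity)]
    exact Nat.le_ceil _
  let F : (Fin k → Fin d × Bool) → (Fin d → ℝ) :=
    fun f i => (∑ t, atomL1 d β (f t) i) / k
  refine ⟨Finset.univ.image F, ?_, ?_⟩
  · intro v hv
    obtain ⟨f, hf⟩ := atomL1_seq d hd β hβ v hv k
    refine ⟨F f, Finset.mem_image_of_mem _ (Finset.mem_univ _), ?_⟩
    rw [Real.sqrt_le_left hε.le]
    have : ∀ i, (v i - F f i) ^ 2 = (k * v i - ∑ t, atomL1 d β (f t) i) ^ 2 / (k : ℝ) ^ 2 := by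
      intro i
      simp only [F]
      field_simp
    simp only [this]
    rw [← Finset.sum_div, div_le_iff₀ (by positivity)]
    nlinarith
  · have hcard : (Finset.univ.image F).card ≤ (2 * d) ^ k := by
      refine Finset.card_image_le.trans ?_
      simp [mul_comm]
    haveI : Nonempty (Fin d) := ⟨⟨0, hd⟩⟩
    have hpos : 0 < (Finset.univ.image F).card :=
      Finset.card_pos.mpr (Finset.univ_nonempty.image F)
    rw [← Real.log_pow]
    apply Real.log_le_log
    · exact_mod_cast hpos
    · exact_mod_cast hcard
end

section
/- Let e₁,…,e_d be the standard basis of ℝ^d. For every positive integer k and every a = (a₁,…,a_d) ∈ ℝ₊^d with Σ_{i=1}^d a_i ≤ 1, there exist nonnegative integers k₁,…,k_d such that the vector κ = Σ_{i=1}^d e_i · (k_i/k) satisfies ‖κ − a‖₂² ≤ 1/k. -/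
/-- (Maurey-type sparsification.)  For every positive integer `k`
and every `a ∈ ℝ₊^d` with `∑ i a_i ≤ 1`, there are nonnegative integers
`k₁, …, k_d` such that `κ = ∑ i e_i · (k_i/k)` satisfies `‖κ − a‖₂² ≤ 1/k`. -/
theorem maurey_simplex_sparsification
    (d k : ℕ) (hd : 0 < d) (hk : 0 < k)
    (a : Fin d → ℝ) (ha : ∀ i, 0 ≤ a i) (hsum : (∑ i, a i) ≤ 1) :
    ∃ ks : Fin d → ℕ,
      (∑ i, ((ks i : ℝ) / k - a i) ^ 2) ≤ 1 / k := by
  have hk' : (0 : ℝ) < k := by exact_mod_cast hk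
  refine ⟨fun i => ⌊(k : ℝ) * a i⌋₊, ?_⟩
  have key : ∀ i, (((⌊(k : ℝ) * a i⌋₊ : ℕ) : ℝ) / k - a i) ^ 2 ≤ a i / k := by
    intro i
    have hx : 0 ≤ (k : ℝ) * a i := mul_nonneg hk'.le (ha i)
    have h1 := Nat.floor_le hx
    have h2 := Nat.lt_floor_add_one ((k : ℝ) * a i)
    have h3 : (0 : ℝ) ≤ (⌊(k : ℝ) * a i⌋₊ : ℕ) := Nat.cast_nonneg _
    generalize ((⌊(k : ℝ) * a i⌋₊ : ℕ) : ℝ) = n at *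
    have e1 : (n / k - a i) ^ 2 = (n - k * a i) ^ 2 / (k : ℝ) ^ 2 := by
      field_simp
    have e2 : a i / k = (k * a i) / (k : ℝ) ^ 2 := by
      field_simp
    rw [e1, e2]
    gcongr
    nlinarith
  calc _ ≤ ∑ i, a i / k := Finset.sum_le_sum fun i _ => key i
    _ = (∑ i, a i) / k := by rw [Finset.sum_div]
    _ ≤ 1 / k := by gcongr
end

section
/- Let a, b, ε > 0 and let m, n, U, d be positive integers. Let X ∈ ℝ^{n×U×d} be a tensor with ‖X_{i,u,·}‖₂ ≤ b for all i ∈ {1,…,n} and u ∈ {1,…,U}. Then for any fixed reference matrix M ∈ ℝ^{d×m}, log N({XA : A ∈ ℝ^{d×m}, ‖A−M‖_Fr ≤ a}, ε, ‖·‖_∞) ≤ (36 a² b² / ε²) · log₂((8ab/ε + 7)·m·n·U), where ‖·‖_∞ on ℝ^{n×U×m} is the maximum absolute value of an entry. -/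
lemma perceptron_cover {E ι : Type*} [NormedAddCommGroup E] [InnerProductSpace ℝ E] [Fintype ι]
    (x : ι → E) (b ε : ℝ) (hb : 0 < b) (hε : 0 < ε) (hx : ∀ k, ‖x k‖ ≤ b) (T : ℕ) :
    ∀ w : E, ∃ C : Finset E, C.card ≤ (2 * Fintype.card ι + 1) ^ T ∧
      ∀ A : E, ‖A - w‖ ^ 2 ≤ (T + 1) * (ε ^ 2 / b ^ 2) →
        ∃ c ∈ C, ∀ k, |inner ℝ (x k) A - inner ℝ (x k) c| ≤ ε := by
  classical
  induction T with
  | zero =>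
    intro w
    refine ⟨{w}, by simp, fun A hA => ⟨w, by simp, fun k => ?_⟩⟩
    have h1 : ‖A - w‖ ≤ ε / b := by
      apply le_of_sq_le_sq _ (by positivity)
      rw [div_pow]; simpa using hA
    rw [← inner_sub_right]
    calc |inner ℝ (x k) (A - w)| ≤ ‖x k‖ * ‖A - w‖ := abs_real_inner_le_norm _ _
      _ ≤ b * (ε / b) := by gcongr; exact hx k
      _ = ε := by field_simp
  | succ T ih =>
    intro w
    choose C hcard hC using ih
    refine ⟨insert w (Finset.univ.biUnion fun p : ι × Bool =>
      C (w + ((if p.2 then 1 else -1) * (ε / b ^ 2)) • x p.1)), ?_, ?_⟩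
    · refine (Finset.card_insert_le _ _).trans ?_
      have h1 := Finset.card_biUnion_le_card_mul (Finset.univ : Finset (ι × Bool))
        (fun p => C (w + ((if p.2 then 1 else -1) * (ε / b ^ 2)) • x p.1)) _
        (fun p _ => hcard _)
      simp only [Finset.card_univ, Fintype.card_prod, Fintype.card_bool] at h1
      have h2 : 1 ≤ (2 * Fintype.card ι + 1) ^ T := Nat.one_le_pow _ _ (by omega)
      have h3 : (2 * Fintype.card ι + 1) ^ (T + 1) =
        Fintype.card ι * 2 * (2 * Fintype.card ι + 1) ^ T + (2 * Fintype.card ι + 1) ^ T := by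
        ring
      rw [h3]
      exact Nat.add_le_add h1 h2
    · intro A hA
      by_cases h : ∀ k, |inner ℝ (x k) A - inner ℝ (x k) w| ≤ ε
      · exact ⟨w, by simp, h⟩
      · push Not at h
        obtain ⟨k, hk⟩ := h
        rw [← inner_sub_right] at hk
        have key : ∃ s : Bool, ε ≤ (if s then 1 else -1) * inner ℝ (x k) (A - w) := by
          rcases lt_abs.1 hk with h | h
          · exact ⟨true, by simpa using h.le⟩
          · exact ⟨false, by simpa using h.le⟩
        obtain ⟨s, hs⟩ := key
        obtain ⟨c, hc, hc'⟩ := hC (w + ((if s then 1 else -1) * (ε / b ^ 2)) • x k) A (by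
          have hsig : ((if s then 1 else -1 : ℝ)) ^ 2 = 1 := by cases s <;> simp
          generalize (if s then 1 else -1 : ℝ) = σ at *
          rw [← sub_sub, norm_sub_sq_real, inner_smul_right, norm_smul, mul_pow,
            Real.norm_eq_abs, sq_abs, mul_pow, hsig, real_inner_comm]
          push_cast at hA
          have e1 : (ε / b ^ 2) ^ 2 * ‖x k‖ ^ 2 ≤ ε ^ 2 / b ^ 2 := by
            calc (ε / b ^ 2) ^ 2 * ‖x k‖ ^ 2 ≤ (ε / b ^ 2) ^ 2 * b ^ 2 := by
                  gcongr; exact hx k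
              _ = ε ^ 2 / b ^ 2 := by field_simp
          have e2 : ε ^ 2 / b ^ 2 ≤ (ε / b ^ 2) * (σ * inner ℝ (x k) (A - w)) := by
            calc ε ^ 2 / b ^ 2 = (ε / b ^ 2) * ε := by ring
              _ ≤ _ := by gcongr
          linarith)
        refine ⟨c, ?_, hc'⟩
        simp only [Finset.mem_insert, Finset.mem_biUnion, Finset.mem_univ, true_and]
        exact Or.inr ⟨(k, s), hc⟩


/-- (One-layer `L^∞` covering bound, Frobenius constraint;
Proposition `suplinn` of the paper.)  Let `a, b, ε > 0`, let `X ∈ ℝ^{n×U×d}` be a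
tensor whose fibres `X_{i,u,·}` have Euclidean norm at most `b`, and let
`M ∈ ℝ^{d×m}` be a fixed reference matrix.  Then
`log N({XA : ‖A−M‖_Fr ≤ a}, ε, ‖·‖_∞) ≤ (36a²b²/ε²)·log₂((8ab/ε + 7)·m·n·U)`,
where `(XA)_{i,u,j} = ∑ₒ X_{i,u,o} A_{o,j}` and `‖·‖_∞` is the maximum absolute
entry on `ℝ^{n×U×m}`.  The covering number statement is rendered as the existence
of a finite cover whose cardinality has logarithm at most the bound. -/
theorem one_layer_sup_covering_frobenius
    (n U d m : ℕ) (hn : 0 < n) (hU : 0 < U) (hd : 0 < d) (hm : 0 < m)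
    (a b ε : ℝ) (ha : 0 < a) (hb : 0 < b) (hε : 0 < ε)
    (X : Fin n → Fin U → Fin d → ℝ)
    (hX : ∀ (i : Fin n) (u : Fin U), Real.sqrt (∑ o, (X i u o) ^ 2) ≤ b)
    (M : Fin d → Fin m → ℝ) :
    ∃ C : Finset (Fin n → Fin U → Fin m → ℝ),
      (∀ A : Fin d → Fin m → ℝ,
        Real.sqrt (∑ o, ∑ j, (A o j - M o j) ^ 2) ≤ a →
        ∃ c ∈ C, ∀ (i : Fin n) (u : Fin U) (j : Fin m),
          |(∑ o, X i u o * A o j) - c i u j| ≤ ε) ∧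
      Real.log (C.card : ℝ) ≤
        (36 * a ^ 2 * b ^ 2 / ε ^ 2) *
          Real.logb 2 ((8 * a * b / ε + 7) * m * n * U) := by
  classical
  let x : Fin n × Fin U × Fin m → EuclideanSpace ℝ (Fin d × Fin m) := fun k =>
    WithLp.toLp 2 (fun p => if p.2 = k.2.2 then X k.1 k.2.1 p.1 else 0)
  let v : (Fin d → Fin m → ℝ) → EuclideanSpace ℝ (Fin d × Fin m) := fun A =>
    WithLp.toLp 2 (fun p => A p.1 p.2)
  have hx : ∀ k, ‖x k‖ ≤ b := by
    intro k
    refine le_trans (le_of_eq ?_) (hX k.1 k.2.1)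
    rw [EuclideanSpace.norm_eq]
    congr 1
    simp [x, Fintype.sum_prod_type, ite_pow]
  have hin : ∀ i u j A, inner ℝ (x (i, u, j)) (v A) = ∑ o, X i u o * A o j := by
    intro i u j A
    simp [x, v, PiLp.inner_apply, Fintype.sum_prod_type, mul_comm]
  have hnorm : ∀ A, ‖v A - v M‖ = Real.sqrt (∑ o, ∑ j, (A o j - M o j) ^ 2) := by
    intro A
    rw [EuclideanSpace.norm_eq]
    simp [v, Fintype.sum_prod_type]
  set r : ℝ := a ^ 2 * b ^ 2 / ε ^ 2 with hr
  have hr0 : 0 ≤ r := by positivity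
  obtain ⟨C, hcard, hC⟩ := perceptron_cover x b ε hb hε hx ⌊r⌋₊ (v M)
  refine ⟨C.image (fun c i u j => inner ℝ (x (i, u, j)) c), ?_, ?_⟩
  · intro A hA
    obtain ⟨c, hc, hc'⟩ := hC (v A) (by
      rw [hnorm]
      calc _ ≤ a ^ 2 := by gcongr
        _ = r * (ε ^ 2 / b ^ 2) := by rw [hr]; field_simp
        _ ≤ _ := by gcongr; exact (Nat.lt_floor_add_one r).le)
    refine ⟨_, Finset.mem_image_of_mem _ hc, fun i u j => ?_⟩
    rw [← hin]
    exact hc' _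
  · have hN : (1:ℝ) ≤ (m:ℝ) * n * U := by
      have : 1 ≤ m * n * U := Nat.succ_le_of_lt (by positivity)
      exact_mod_cast this
    set N : ℝ := (m:ℝ) * n * U with hNdef
    have hq : 0 ≤ 8 * a * b / ε := by positivity
    have hbase : 2 * N + 1 ≤ (8 * a * b / ε + 7) * N := by nlinarith
    have hbase' : (8 * a * b / ε + 7) * m * n * U = (8 * a * b / ε + 7) * N := by
      rw [hNdef]; ring
    rw [hbase']
    set Y := (8 * a * b / ε + 7) * N
    have hlog0 : 0 ≤ Real.log Y := Real.log_nonneg (by linarith)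
    have hlogb : Real.log Y ≤ Real.logb 2 Y := by
      rw [Real.logb, le_div_iff₀ (Real.log_pos (by norm_num))]
      have := Real.log_two_lt_d9
      nlinarith
    have hcard2 : (((C.image (fun c i u j => inner ℝ (x (i, u, j)) c)).card : ℕ) : ℝ)
        ≤ Y ^ ⌊r⌋₊ := by
      have h1 := (Finset.card_image_le
        (f := (fun c (i : Fin n) (u : Fin U) (j : Fin m) => inner ℝ (x (i, u, j)) c))).trans hcard
      have h2 : (((C.image (fun c i u j => inner ℝ (x (i, u, j)) c)).card : ℕ) : ℝ)
        ≤ (2 * (n * (U * m)) + 1) ^ ⌊r⌋₊ := by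
        have h3 := (Nat.cast_le (α := ℝ)).2 h1
        simpa using h3
      refine h2.trans ?_
      gcongr
      calc (2 * ((n:ℝ) * (U * m)) + 1) = 2 * N + 1 := by rw [hNdef]; ring
        _ ≤ Y := hbase
    have hfl : (⌊r⌋₊ : ℝ) ≤ r := Nat.floor_le hr0
    have h36 : 36 * a ^ 2 * b ^ 2 / ε ^ 2 = 36 * r := by rw [hr]; ring
    rw [h36]
    have hfin : (⌊r⌋₊ : ℝ) * Real.log Y ≤ 36 * r * Real.logb 2 Y := by
      apply mul_le_mul _ hlogb hlog0 (by positivity)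
      linarith
    refine le_trans ?_ hfin
    rw [← Real.log_pow]
    rcases Nat.eq_zero_or_pos (C.image (fun c i u j => inner ℝ (x (i, u, j)) c)).card with h0 | h0
    · rw [h0]
      simp only [Nat.cast_zero, Real.log_zero, Real.log_pow]
      positivity
    · exact Real.log_le_log (by exact_mod_cast h0) hcard2
end

section
/- Let a, b, ε > 0 and let m, n, U, d be positive integers. Let X ∈ ℝ^{n×U×d} be a tensor with ‖X_{i,u,·}‖₂ ≤ b for all i ∈ {1,…,n} and u ∈ {1,…,U}. Then for any fixed reference matrix M ∈ ℝ^{d×m}, log N({XA : A ∈ ℝ^{d×m}, ‖A−M‖_{2,1} ≤ a}, ε, ‖·‖_*) ≤ (64 a² b² / ε²) · log₂((8ab/ε + 7)·m·n·U), where ‖Y‖_* = max_{i≤n} max_{j≤U} (Σ_{k=1}^m Y_{i,j,k}²)^{1/2} for Y ∈ ℝ^{n×U×m}. -/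
open scoped RealInnerProductSpace in
lemma aux_sq {E : Type*} [NormedAddCommGroup E] [InnerProductSpace ℝ E]
    (x w : E) (b e s : ℝ) (hb : 0 < b) (he : 0 < e) (hx : ‖x‖ ≤ b) (hs : s ^ 2 = 1)
    (h : e ≤ s * inner ℝ x w) :
    ‖w - (e / b ^ 2) • (s • x)‖ ^ 2 ≤ ‖w‖ ^ 2 - e ^ 2 / b ^ 2 := by
  rw [norm_sub_sq_real, inner_smul_right, inner_smul_right, norm_smul, norm_smul, mul_pow, mul_pow,
    Real.norm_eq_abs, Real.norm_eq_abs, sq_abs, sq_abs, hs, real_inner_comm]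
  have h1 : ‖x‖ ^ 2 ≤ b ^ 2 := by gcongr
  have h2 : e / b ^ 2 * e ≤ e / b ^ 2 * (s * inner ℝ x w) := by gcongr
  have h3 : (e / b ^ 2) ^ 2 * ‖x‖ ^ 2 ≤ (e / b ^ 2) ^ 2 * b ^ 2 := by gcongr
  have h4 : (e / b ^ 2) ^ 2 * b ^ 2 = e ^ 2 / b ^ 2 := by field_simp
  have h5 : e / b ^ 2 * e = e ^ 2 / b ^ 2 := by ring
  linarith

def auxVal {E P : Type*} [NormedAddCommGroup E] (x : P → E) : Option (P × Bool) → E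
  | none => 0
  | some (p, true) => x p
  | some (p, false) => - x p

lemma aux_perc {E P ι : Type*} [NormedAddCommGroup E] [InnerProductSpace ℝ E] [DecidableEq ι]
    (x : P → E) (b e : ℝ) (hb : 0 < b) (he : 0 ≤ e) (hx : ∀ p, ‖x p‖ ≤ b) (s : Finset ι) :
    ∀ w : E, ‖w‖ ^ 2 ≤ s.card * (e ^ 2 / b ^ 2) →
    ∃ y : ι → Option (P × Bool), ∀ p,
      |inner ℝ (x p) (w - (e / b ^ 2) • ∑ i ∈ s, auxVal x (y i))| ≤ e := by
  induction s using Finset.induction_on with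
  | empty =>
    intro w hw
    refine ⟨fun _ => none, fun p => ?_⟩
    have : w = 0 := by
      have : ‖w‖ ^ 2 ≤ 0 := by simpa using hw
      have : ‖w‖ = 0 := by nlinarith [norm_nonneg w]
      simpa using this
    simpa [this] using he
  | insert i s hi ih =>
    intro w hw
    by_cases h : ∀ p, |inner ℝ (x p) w| ≤ e
    · exact ⟨fun _ => none, fun p => by simpa [auxVal] using h p⟩
    push Not at h
    obtain ⟨p, hp⟩ := h
    rcases he.eq_or_lt with he0 | he0
    · exfalso
      subst he0
      have : ‖w‖ ^ 2 ≤ 0 := by simpa using hw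
      have : ‖w‖ = 0 := by nlinarith [norm_nonneg w]
      have : w = 0 := by simpa using this
      simp [this] at hp
    rw [Finset.card_insert_of_notMem hi] at hw
    push_cast at hw
    have key : ∃ z : Option (P × Bool),
        ‖w - (e / b ^ 2) • auxVal x z‖ ^ 2 ≤ ‖w‖ ^ 2 - e ^ 2 / b ^ 2 := by
      rcases le_total 0 (inner ℝ (x p) w) with h0 | h0
      · rw [abs_of_nonneg h0] at hp
        refine ⟨some (p, true), ?_⟩
        have := aux_sq (x p) w b e 1 hb he0 (hx p) (by norm_num) (by linarith)
        simpa [auxVal] using this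
      · rw [abs_of_nonpos h0] at hp
        refine ⟨some (p, false), ?_⟩
        have := aux_sq (x p) w b e (-1) hb he0 (hx p) (by norm_num) (by linarith)
        simpa [auxVal] using this
    obtain ⟨z, hz⟩ := key
    obtain ⟨y, hy⟩ := ih (w - (e / b ^ 2) • auxVal x z) (by linarith)
    refine ⟨Function.update y i z, fun q => ?_⟩
    rw [Finset.sum_insert hi, Function.update_self]
    have : ∑ j ∈ s, auxVal x (Function.update y i z j) = ∑ j ∈ s, auxVal x (y j) := by
      refine Finset.sum_congr rfl fun j hj => ?_
      rw [Function.update_of_ne]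
      rintro rfl
      exact hi hj
    rw [this, smul_add, ← sub_sub]
    exact hy q

lemma aux_fiber (m L : ℕ) (T : Fin m → ℕ) (h : ∑ j, T j ≤ L) :
    ∃ g : Fin L → Option (Fin m), ∀ j, (Finset.univ.filter fun l => g l = some j).card = T j := by
  obtain ⟨e⟩ : Nonempty ((Σ j, Fin (T j)) ↪ Fin L) := by
    apply Function.Embedding.nonempty_of_card_le
    simpa using h
  refine ⟨Function.extend e (fun s => some s.1) (fun _ => none), fun j => ?_⟩
  have : (Finset.univ.filter fun l =>
      Function.extend e (fun s => some s.1) (fun _ => none) l = some j)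
      = (Finset.univ : Finset (Fin (T j))).image (fun t => e ⟨j, t⟩) := by
    ext l
    simp only [Finset.mem_filter, Finset.mem_univ, true_and, Finset.mem_image]
    constructor
    · intro hl
      by_cases hx : ∃ s, e s = l
      · obtain ⟨⟨j', t⟩, rfl⟩ := hx
        rw [e.injective.extend_apply] at hl
        simp only [Option.some.injEq] at hl
        subst hl
        exact ⟨t, rfl⟩
      · rw [Function.extend_apply' _ _ _ hx] at hl
        simp at hl
    · rintro ⟨t, rfl⟩
      rw [e.injective.extend_apply]
  rw [this, Finset.card_image_of_injective]
  · simp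
  · intro t t' htt
    have := e.injective htt
    simpa using this

lemma aux_num (a b ε r T : ℝ) (ha : 0 < a) (hb : 0 < b) (hε : 0 < ε)
    (h1 : r / (ε ^ 2 / (4 * a * b ^ 2)) ≤ 2 * T) (hr : 0 ≤ r) :
    r ^ 2 ≤ T * (T * (ε ^ 2 / (4 * a * b ^ 2)) * ε ^ 2 / a / b ^ 2) := by
  set δ := ε ^ 2 / (4 * a * b ^ 2) with hδ
  have hδ0 : 0 < δ := by positivity
  have h2 : r ≤ 2 * T * δ := by rwa [div_le_iff₀ hδ0] at h1
  have h3 : T * (T * δ * ε ^ 2 / a / b ^ 2) = (2 * T * δ) ^ 2 := by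
    have : ε ^ 2 = δ * (4 * a * b ^ 2) := by rw [hδ]; field_simp
    rw [this]; field_simp; ring
  rw [h3]
  gcongr

lemma aux_log (n U m L : ℕ) (hn : 0 < n) (hU : 0 < U) (hm : 0 < m) (R K : ℝ) (hR : 0 ≤ R)
    (hL : (L : ℝ) ≤ 4 * R ^ 2) (hK : 0 < K)
    (h : K ≤ (((m + 1) * (2 * (n * U) + 1) : ℕ) : ℝ) ^ L) :
    Real.log K ≤ 64 * R ^ 2 * Real.logb 2 ((8 * R + 7) * m * n * U) := by
  have hn' : (1 : ℝ) ≤ n := by exact_mod_cast hn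
  have hU' : (1 : ℝ) ≤ U := by exact_mod_cast hU
  have hm' : (1 : ℝ) ≤ m := by exact_mod_cast hm
  have hnU : (1 : ℝ) ≤ n * U := by nlinarith
  set Q := (8 * R + 7) * m * n * U with hQ
  have h1 : (((m + 1) * (2 * (n * U) + 1) : ℕ) : ℝ) ≤ Q := by
    push_cast
    calc ((m : ℝ) + 1) * (2 * (n * U) + 1) ≤ (2 * m) * (3 * (n * U)) := by gcongr <;> linarith
      _ = 6 * (m * n * U) := by ring
      _ ≤ (8 * R + 7) * (m * n * U) := by gcongr; linarith
      _ = Q := by rw [hQ]; ring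
  have hQ1 : 1 ≤ Q := by
    refine le_trans ?_ h1
    exact_mod_cast Nat.mul_pos (Nat.succ_pos _) (Nat.succ_pos _)
  have hlQ : 0 ≤ Real.log Q := Real.log_nonneg hQ1
  have h2 : Real.log K ≤ L * Real.log Q := by
    rw [← Real.log_pow]
    apply Real.log_le_log hK
    refine h.trans ?_
    gcongr
  have h3 : Real.log Q ≤ Real.logb 2 Q := by
    rw [Real.logb, le_div_iff₀ (Real.log_pos (by norm_num))]
    have : Real.log 2 ≤ 1 := by linarith [Real.log_two_lt_d9]
    nlinarith
  calc Real.log K ≤ L * Real.log Q := h2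
    _ ≤ (4 * R ^ 2) * Real.log Q := by gcongr
    _ ≤ (64 * R ^ 2) * Real.logb 2 Q := by
      apply mul_le_mul _ h3 hlQ (by positivity)
      nlinarith [sq_nonneg R]

/-- (One-layer `L^∞` covering bound, `(2,1)`-norm constraint;
Proposition `suplin` of the paper.)  Let `a, b, ε > 0`, let `X ∈ ℝ^{n×U×d}` be a
tensor whose fibres `X_{i,u,·}` have Euclidean norm at most `b`, and let
`M ∈ ℝ^{d×m}` be a fixed reference matrix.  Then
`log N({XA : ‖A−M‖_{2,1} ≤ a}, ε, ‖·‖_*) ≤ (64a²b²/ε²)·log₂((8ab/ε + 7)·m·n·U)`,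
where `(XA)_{i,u,j} = ∑ₒ X_{i,u,o} A_{o,j}`, `‖A‖_{2,1}` is the sum over columns of
the Euclidean norms of the columns, and
`‖Y‖_* = max_{i,u} (∑_k Y_{i,u,k}²)^{1/2}` on `ℝ^{n×U×m}`.  The covering number
statement is rendered as the existence of a finite cover whose cardinality has
logarithm at most the bound. -/
theorem one_layer_sup_covering_two_one
    (n U d m : ℕ) (hn : 0 < n) (hU : 0 < U) (hd : 0 < d) (hm : 0 < m)
    (a b ε : ℝ) (ha : 0 < a) (hb : 0 < b) (hε : 0 < ε)
    (X : Fin n → Fin U → Fin d → ℝ)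
    (hX : ∀ (i : Fin n) (u : Fin U), Real.sqrt (∑ o, (X i u o) ^ 2) ≤ b)
    (M : Fin d → Fin m → ℝ) :
    ∃ C : Finset (Fin n → Fin U → Fin m → ℝ),
      (∀ A : Fin d → Fin m → ℝ,
        (∑ j, Real.sqrt (∑ o, (A o j - M o j) ^ 2)) ≤ a →
        ∃ c ∈ C, ∀ (i : Fin n) (u : Fin U),
          Real.sqrt (∑ k, ((∑ o, X i u o * A o k) - c i u k) ^ 2) ≤ ε) ∧
      Real.log (C.card : ℝ) ≤
        (64 * a ^ 2 * b ^ 2 / ε ^ 2) *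
          Real.logb 2 ((8 * a * b / ε + 7) * m * n * U) := by
  classical
  set δ := ε ^ 2 / (4 * a * b ^ 2) with hδ
  have hδ0 : 0 < δ := by positivity
  set L := ⌊4 * (a * b / ε) ^ 2⌋₊ with hL
  let x : Fin n × Fin U → EuclideanSpace ℝ (Fin d) := fun p => WithLp.toLp 2 (X p.1 p.2)
  have hx : ∀ p, ‖x p‖ ≤ b := fun p => by
    rw [EuclideanSpace.norm_eq]
    simpa [x] using hX p.1 p.2
  let ee : ℕ → ℝ := fun T => Real.sqrt (T * δ * ε ^ 2 / a)
  have hee : ∀ T : ℕ, ee T ^ 2 = T * δ * ε ^ 2 / a := fun T => Real.sq_sqrt (by positivity)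
  let F : (Fin L → Option (Fin m) × Option ((Fin n × Fin U) × Bool)) →
      (Fin n → Fin U → Fin m → ℝ) := fun f i u k =>
    (∑ o, X i u o * M o k) + inner ℝ (x (i, u))
      ((ee (Finset.univ.filter fun l => (f l).1 = some k).card / b ^ 2) •
        ∑ l ∈ Finset.univ.filter (fun l => (f l).1 = some k), auxVal x (f l).2)
  refine ⟨Finset.univ.image F, ?_, ?_⟩
  · intro A hA
    let w : Fin m → EuclideanSpace ℝ (Fin d) := fun j => WithLp.toLp 2 (fun o => A o j - M o j)
    have hw : ∀ j, ‖w j‖ = Real.sqrt (∑ o, (A o j - M o j) ^ 2) := fun j => by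
      rw [EuclideanSpace.norm_eq]; simp [w]
    simp only [← hw] at hA
    let T : Fin m → ℕ := fun j => ⌊‖w j‖ / δ⌋₊
    have hT : ∀ j, (T j : ℝ) ≤ ‖w j‖ / δ := fun j => Nat.floor_le (by positivity)
    have hTL : ∑ j, T j ≤ L := by
      apply Nat.le_floor
      push_cast
      calc ∑ j, (T j : ℝ) ≤ ∑ j, ‖w j‖ / δ := Finset.sum_le_sum fun j _ => hT j
        _ = (∑ j, ‖w j‖) / δ := by rw [Finset.sum_div]
        _ ≤ a / δ := by gcongr
        _ = 4 * (a * b / ε) ^ 2 := by rw [hδ]; field_simp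
    obtain ⟨g, hg⟩ := aux_fiber m L T hTL
    have main : ∀ j, ∃ y : Fin L → Option ((Fin n × Fin U) × Bool), ∀ p,
        (inner ℝ (x p) (w j - (ee (T j) / b ^ 2) •
          ∑ l ∈ Finset.univ.filter (fun l => g l = some j), auxVal x (y l))) ^ 2
          ≤ ‖w j‖ * ε ^ 2 / a := by
      intro j
      rcases Nat.eq_zero_or_pos (T j) with h0 | h0
      · refine ⟨fun _ => none, fun p => ?_⟩
        have h1 : ‖w j‖ / δ < 1 := by
          have := Nat.lt_floor_add_one (‖w j‖ / δ)
          change ‖w j‖ / δ < (T j : ℝ) + 1 at this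
          simpa [h0] using this
        rw [div_lt_one hδ0] at h1
        simp only [auxVal, Finset.sum_const_zero, smul_zero, sub_zero]
        have h2 : |inner ℝ (x p) (w j)| ≤ b * ‖w j‖ :=
          (abs_real_inner_le_norm _ _).trans (by gcongr; exact hx p)
        calc (inner ℝ (x p) (w j)) ^ 2 = |inner ℝ (x p) (w j)| ^ 2 := (sq_abs _).symm
          _ ≤ (b * ‖w j‖) ^ 2 := by gcongr
          _ = ‖w j‖ * (b ^ 2 * ‖w j‖) := by ring
          _ ≤ ‖w j‖ * (b ^ 2 * (4 * δ)) := by gcongr; linarith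
          _ = ‖w j‖ * ε ^ 2 / a := by rw [hδ]; field_simp
      · have h1 : ‖w j‖ / δ ≤ 2 * (T j : ℝ) := by
          have := Nat.lt_floor_add_one (‖w j‖ / δ)
          change ‖w j‖ / δ < (T j : ℝ) + 1 at this
          have h2 : (1 : ℝ) ≤ T j := by exact_mod_cast h0
          linarith
        have h3 := aux_num a b ε ‖w j‖ (T j) ha hb hε h1 (norm_nonneg _)
        obtain ⟨y, hy⟩ := aux_perc x b (ee (T j)) hb (Real.sqrt_nonneg _) hx
          (Finset.univ.filter (fun l => g l = some j)) (w j) (by rw [hg, hee]; exact h3)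
        refine ⟨y, fun p => ?_⟩
        rw [← sq_abs]
        calc _ ≤ ee (T j) ^ 2 := by gcongr; exact hy p
          _ = T j * δ * ε ^ 2 / a := hee _
          _ ≤ ‖w j‖ * ε ^ 2 / a := by
            gcongr
            exact (le_div_iff₀ hδ0).1 (hT j)
    choose y hy using main
    let f : Fin L → Option (Fin m) × Option ((Fin n × Fin U) × Bool) := fun l =>
      (g l, match g l with
        | none => none
        | some j => y j l)
    refine ⟨F f, Finset.mem_image_of_mem _ (Finset.mem_univ _), fun i u => ?_⟩
    apply Real.sqrt_le_iff.2 ⟨hε.le, ?_⟩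
    have hk : ∀ k, ((∑ o, X i u o * A o k) - F f i u k) ^ 2 ≤ ‖w k‖ * ε ^ 2 / a := by
      intro k
      have h1 : F f i u k = (∑ o, X i u o * M o k) + inner ℝ (x (i, u))
          ((ee (T k) / b ^ 2) •
            ∑ l ∈ Finset.univ.filter (fun l => g l = some k), auxVal x (y k l)) := by
        simp only [F]
        rw [← hg k]
        congr 3
        refine Finset.sum_congr rfl fun l hl => ?_
        have : g l = some k := by simpa [f] using hl
        simp [f, this]
      have h2 : inner ℝ (x (i, u)) (w k) = (∑ o, X i u o * A o k) - ∑ o, X i u o * M o k := by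
        rw [← Finset.sum_sub_distrib]
        simp only [x, w, PiLp.inner_apply]
        refine Finset.sum_congr rfl fun o _ => ?_
        simp
        ring
      have h3 := hy k (i, u)
      rw [inner_sub_right, h2] at h3
      rw [h1, ← sub_sub]
      exact h3
    calc _ ≤ ∑ k, ‖w k‖ * ε ^ 2 / a := Finset.sum_le_sum fun k _ => hk k
      _ = (∑ k, ‖w k‖) * ε ^ 2 / a := by rw [Finset.sum_mul, Finset.sum_div]
      _ ≤ a * ε ^ 2 / a := by gcongr
      _ = ε ^ 2 := by field_simp
  · have hR : (0 : ℝ) ≤ a * b / ε := by positivity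
    have hne : (Finset.univ.image F).Nonempty :=
      ⟨F (fun _ => (none, none)), Finset.mem_image_of_mem _ (Finset.mem_univ _)⟩
    have := aux_log n U m L hn hU hm (a * b / ε) ((Finset.univ.image F).card : ℝ) hR
      (Nat.floor_le (by positivity)) (by exact_mod_cast hne.card_pos) (by
        have h := Finset.card_image_le (s := Finset.univ) (f := F)
        have h2 : (Finset.univ : Finset (Fin L → Option (Fin m) × Option ((Fin n × Fin U) × Bool))).card
          = ((m + 1) * (2 * (n * U) + 1)) ^ L := by
          simp [Fintype.card_option, mul_comm]
        rw [h2] at h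
        exact_mod_cast h)
    convert this using 2
    · ring
    · ring_nf
end

section
/- Let 𝓕 be a class of real-valued functions taking values in [0,1] with 0 ∈ 𝓕, and let S = (x₁,…,xₙ) be a finite sample of size n. For any 2 ≤ p ≤ ∞, the empirical Rademacher complexity satisfies Rad(𝓕|_S) ≤ inf_{α>0} ( 4α + (12/√n)·∫_α^1 √( log N(𝓕|S, ε, ‖·‖_p) ) dε ), where ‖x‖_p = ((1/n)·Σ_{i=1}^n |x_i|^p)^{1/p} (with the obvious maximum-norm convention for p = ∞). -/
open scoped BigOperators ENNReal

/-- The empirical `L^p` norm on `ℝ^n` used for covering numbers: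
`‖v‖_p = ((1/n)·∑ |vᵢ|^p)^{1/p}` for finite `p`, and the maximum absolute
coordinate for `p = ∞`. -/
noncomputable def empPNorm (n : ℕ) (p : ℝ≥0∞) (v : Fin n → ℝ) : ℝ :=
  if p = ⊤ then ⨆ i : Fin n, |v i|
  else ((1 / (n : ℝ)) * ∑ i, |v i| ^ p.toReal) ^ (1 / p.toReal)

/-- The covering number of a function class `𝓕` restricted to the sample `S`,
at scale `ε`, in the empirical `L^p` norm. -/
noncomputable def empCovN {α : Type*} (n : ℕ) (𝓕 : Set (α → ℝ)) (S : Fin n → α)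
    (p : ℝ≥0∞) (ε : ℝ) : ℕ :=
  sInf {m : ℕ | ∃ T : Finset (Fin n → ℝ), T.card = m ∧
    ∀ f ∈ 𝓕, ∃ t ∈ T, empPNorm n p (fun i => f (S i) - t i) ≤ ε}

/-- The empirical Rademacher complexity of `𝓕` on the sample `S`:
`E_σ sup_{f∈𝓕} (1/n)∑ σᵢ f(xᵢ)`, the expectation being the average over all
`2^n` sign vectors. -/
noncomputable def empRad {α : Type*} (n : ℕ) (𝓕 : Set (α → ℝ)) (S : Fin n → α) : ℝ :=
  (1 / (2 ^ n : ℝ)) * ∑ σ : Fin n → Bool,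
    sSup ((fun f : α → ℝ =>
      (1 / (n : ℝ)) * ∑ i, (if σ i then (1 : ℝ) else -1) * f (S i)) '' 𝓕)

lemma emp_sq_le (n : ℕ) (hn : 0 < n) (p : ℝ≥0∞) (hp : 2 ≤ p) (v : Fin n → ℝ) (e : ℝ)
    (h : empPNorm n p v ≤ e) : ∑ i, v i ^ 2 ≤ n * e ^ 2 := by
  have hn' : (0 : ℝ) < n := by exact_mod_cast hn
  unfold empPNorm at h
  split_ifs at h with hpt
  · have hi : ∀ i, v i ^ 2 ≤ e ^ 2 := fun i => by
      have h1 : |v i| ≤ e := le_trans (le_ciSup (f := fun i => |v i|) (Set.finite_range _).bddAbove i) h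
      rw [← sq_abs]
      exact pow_le_pow_left₀ (abs_nonneg _) h1 2
    calc ∑ i, v i ^ 2 ≤ ∑ _i : Fin n, e ^ 2 := Finset.sum_le_sum fun i _ => hi i
      _ = n * e ^ 2 := by simp
  · have hq : (2 : ℝ) ≤ p.toReal := by
      have := ENNReal.toReal_mono hpt hp
      simpa using this
    set q := p.toReal
    have hq0 : 0 < q := by linarith
    have hX0 : 0 ≤ (1 / (n : ℝ)) * ∑ i, |v i| ^ q := by positivity
    set X := (1 / (n : ℝ)) * ∑ i, |v i| ^ q with hX
    have he0 : 0 ≤ e := le_trans (by positivity) h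
    have hXe : X ≤ e ^ q := by
      calc X = (X ^ (1 / q)) ^ q := by
            rw [← Real.rpow_mul hX0]; field_simp; simp
        _ ≤ e ^ q := Real.rpow_le_rpow (by positivity) h hq0.le
    have hJ := Real.rpow_arith_mean_le_arith_mean_rpow Finset.univ (fun _ : Fin n => 1 / (n : ℝ))
      (fun i => v i ^ 2) (fun _ _ => by positivity) (by simp; field_simp)
      (fun _ _ => by positivity) (p := q / 2) (by linarith)
    have hpw : ∀ i, (v i ^ 2) ^ (q / 2) = |v i| ^ q := fun i => by
      rw [← sq_abs, ← Real.rpow_natCast, ← Real.rpow_mul (abs_nonneg _)]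
      congr 1; push_cast; ring
    simp only [hpw, ← Finset.mul_sum] at hJ
    have h2 : (1 / (n : ℝ) * ∑ i, v i ^ 2) ^ (q / 2) ≤ (e ^ 2) ^ (q / 2) := by
      refine hJ.trans (hXe.trans (le_of_eq ?_))
      rw [← Real.rpow_natCast e 2, ← Real.rpow_mul he0]
      congr 1; push_cast; ring
    have h3 := (Real.rpow_le_rpow_iff (by positivity) (by positivity) (by linarith)).1 h2
    rw [one_div, inv_mul_le_iff₀ hn'] at h3
    exact h3

lemma emp_le_of_sup (n : ℕ) (hn : 0 < n) (p : ℝ≥0∞) (hp : 2 ≤ p) (v : Fin n → ℝ) (e : ℝ)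
    (h : ∀ i, |v i| ≤ e) : empPNorm n p v ≤ e := by
  have hn' : (0 : ℝ) < n := by exact_mod_cast hn
  haveI : Nonempty (Fin n) := ⟨⟨0, hn⟩⟩
  have he0 : 0 ≤ e := (abs_nonneg _).trans (h ⟨0, hn⟩)
  unfold empPNorm
  split_ifs with hpt
  · exact ciSup_le h
  · have hq : (2 : ℝ) ≤ p.toReal := by
      have := ENNReal.toReal_mono hpt hp
      simpa using this
    set q := p.toReal
    have hq0 : 0 < q := by linarith
    have h1 : (1 / (n : ℝ)) * ∑ i, |v i| ^ q ≤ e ^ q := by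
      rw [one_div, inv_mul_le_iff₀ hn']
      calc ∑ i, |v i| ^ q ≤ ∑ _i : Fin n, e ^ q :=
            Finset.sum_le_sum fun i _ => Real.rpow_le_rpow (abs_nonneg _) (h i) hq0.le
        _ = n * e ^ q := by simp
    calc _ ≤ (e ^ q) ^ (1 / q) := Real.rpow_le_rpow (by positivity) h1 (by positivity)
      _ = e := by rw [← Real.rpow_mul he0]; field_simp; simp

lemma emp_cov_nonempty {α : Type*} (n : ℕ) (hn : 0 < n) (𝓕 : Set (α → ℝ)) (S : Fin n → α)
    (h𝓕 : ∀ f ∈ 𝓕, ∀ x, f x ∈ Set.Icc (0 : ℝ) 1) (p : ℝ≥0∞) (hp : 2 ≤ p) (e : ℝ) (he : 0 < e) :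
    {m : ℕ | ∃ T : Finset (Fin n → ℝ), T.card = m ∧
    ∀ f ∈ 𝓕, ∃ t ∈ T, empPNorm n p (fun i => f (S i) - t i) ≤ e}.Nonempty := by
  have hc : IsCompact (Set.Icc (0 : Fin n → ℝ) 1) := isCompact_Icc
  obtain ⟨t, ht, hcov⟩ := Metric.totallyBounded_iff.1 hc.totallyBounded e he
  refine ⟨_, ht.toFinset, rfl, fun f hf => ?_⟩
  have hm : (fun i => f (S i)) ∈ Set.Icc (0 : Fin n → ℝ) 1 :=
    ⟨fun i => (h𝓕 f hf _).1, fun i => (h𝓕 f hf _).2⟩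
  have := hcov hm
  simp only [Set.mem_iUnion, Metric.mem_ball] at this
  obtain ⟨y, hy, hd⟩ := this
  refine ⟨y, by simpa using hy, emp_le_of_sup n hn p hp _ _ fun i => ?_⟩
  have := dist_le_pi_dist (fun i => f (S i)) y i
  rw [Real.dist_eq] at this
  linarith

/-- expectation over signs -/
noncomputable def sgnE (n : ℕ) (g : (Fin n → Bool) → ℝ) : ℝ := (1 / (2 ^ n : ℝ)) * ∑ σ, g σ

/-- sign inner product -/
noncomputable def sgnIP (n : ℕ) (σ : Fin n → Bool) (v : Fin n → ℝ) : ℝ :=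
  ∑ i, (if σ i then (1 : ℝ) else -1) * v i

lemma sgnE_mono {n : ℕ} {g h : (Fin n → Bool) → ℝ} (H : ∀ σ, g σ ≤ h σ) : sgnE n g ≤ sgnE n h :=
  mul_le_mul_of_nonneg_left (Finset.sum_le_sum fun σ _ => H σ) (by positivity)

lemma sgnE_const (n : ℕ) (c : ℝ) : sgnE n (fun _ => c) = c := by
  simp [sgnE]

lemma sgnE_add (n : ℕ) (g h : (Fin n → Bool) → ℝ) :
    sgnE n (fun σ => g σ + h σ) = sgnE n g + sgnE n h := by
  simp [sgnE, Finset.sum_add_distrib, mul_add]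

lemma sgnE_smul (n : ℕ) (c : ℝ) (h : (Fin n → Bool) → ℝ) :
    sgnE n (fun σ => c * h σ) = c * sgnE n h := by
  simp only [sgnE, ← Finset.mul_sum]; ring

lemma sgnIP_sub (n : ℕ) (σ : Fin n → Bool) (u v : Fin n → ℝ) :
    sgnIP n σ (fun i => u i - v i) = sgnIP n σ u - sgnIP n σ v := by
  simp [sgnIP, mul_sub, Finset.sum_sub_distrib]

lemma sgn_mgf (n : ℕ) (l : ℝ) (v : Fin n → ℝ) :
    sgnE n (fun σ => Real.exp (l * sgnIP n σ v)) ≤ Real.exp (l ^ 2 * (∑ i, v i ^ 2) / 2) := by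
  have h1 : ∑ σ : Fin n → Bool, Real.exp (l * sgnIP n σ v)
      = ∏ i, ∑ b : Bool, Real.exp (l * ((if b then (1 : ℝ) else -1) * v i)) := by
    rw [Finset.prod_univ_sum, Fintype.piFinset_univ]
    refine Finset.sum_congr rfl fun σ _ => ?_
    rw [← Real.exp_sum, sgnIP, Finset.mul_sum]
  have h2 : ∀ i, ∑ b : Bool, Real.exp (l * ((if b then (1 : ℝ) else -1) * v i))
      = 2 * Real.cosh (l * v i) := fun i => by
    rw [Real.cosh_eq]; simp; ring
  unfold sgnE
  rw [h1]
  simp only [h2, Finset.prod_mul_distrib]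
  simp only [Finset.prod_const, Finset.card_univ, Fintype.card_fin]
  rw [← mul_assoc, one_div, inv_mul_cancel₀ (by positivity), one_mul]
  calc ∏ i, Real.cosh (l * v i) ≤ ∏ i, Real.exp ((l * v i) ^ 2 / 2) :=
        Finset.prod_le_prod (fun i _ => (Real.cosh_pos _).le) fun i _ => Real.cosh_le_exp_half_sq _
    _ = _ := by
        rw [← Real.exp_sum]; congr 1
        rw [← Finset.sum_div, Finset.mul_sum]; simp only [mul_pow]

lemma massart (n : ℕ) (A : Finset (Fin n → ℝ)) (R : ℝ) (hR : 0 < R) (L : ℝ)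
    (hA : ∀ v ∈ A, ∑ i, v i ^ 2 ≤ R ^ 2) (hL0 : 0 ≤ L) (hL : Real.log A.card ≤ L)
    (V : (Fin n → Bool) → (Fin n → ℝ)) (hV : ∀ σ, V σ ∈ A) :
    sgnE n (fun σ => sgnIP n σ (V σ)) ≤ R * Real.sqrt (2 * L) := by
  set x := sgnE n (fun σ => sgnIP n σ (V σ)) with hx
  have hApos : (0 : ℝ) < A.card := by
    exact_mod_cast Finset.card_pos.2 ⟨_, hV (fun _ => true)⟩
  have key : ∀ l : ℝ, l * x ≤ L + l ^ 2 * R ^ 2 / 2 := fun l => by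
    have hJ : Real.exp (l * x) ≤ sgnE n (fun σ => Real.exp (l * sgnIP n σ (V σ))) := by
      have := convexOn_exp.map_sum_le (t := (Finset.univ : Finset (Fin n → Bool)))
        (w := fun _ => 1 / (2 ^ n : ℝ)) (p := fun σ => l * sgnIP n σ (V σ))
        (fun _ _ => by positivity) (by simp) (fun _ _ => Set.mem_univ _)
      simp only [smul_eq_mul, ← Finset.mul_sum] at this
      rw [hx]; unfold sgnE
      rw [mul_left_comm]
      exact this
    have h2 : sgnE n (fun σ => Real.exp (l * sgnIP n σ (V σ)))
        ≤ A.card * Real.exp (l ^ 2 * R ^ 2 / 2) := by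
      calc _ ≤ sgnE n (fun σ => ∑ v ∈ A, Real.exp (l * sgnIP n σ v)) :=
            sgnE_mono fun σ => Finset.single_le_sum
              (f := fun v => Real.exp (l * sgnIP n σ v)) (fun _ _ => (Real.exp_pos _).le) (hV σ)
        _ = ∑ v ∈ A, sgnE n (fun σ => Real.exp (l * sgnIP n σ v)) := by
            unfold sgnE; rw [Finset.sum_comm, Finset.mul_sum]
        _ ≤ ∑ v ∈ A, Real.exp (l ^ 2 * R ^ 2 / 2) := Finset.sum_le_sum fun v hv =>
            (sgn_mgf n l v).trans (Real.exp_le_exp.2 (by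
              have := mul_le_mul_of_nonneg_left (hA v hv) (sq_nonneg l); linarith))
        _ = _ := by simp
    have h3 := Real.log_le_log (Real.exp_pos _) (hJ.trans h2)
    rw [Real.log_exp, Real.log_mul hApos.ne' (Real.exp_pos _).ne', Real.log_exp] at h3
    linarith
  by_contra hlt
  push Not at hlt
  have h0 : 0 ≤ R * Real.sqrt (2 * L) := by positivity
  have hsq : R ^ 2 * (2 * L) < x ^ 2 := by
    have := pow_lt_pow_left₀ hlt h0 (n := 2) (by norm_num)
    rwa [mul_pow, Real.sq_sqrt (by positivity)] at this
  have h4 := key (x / R ^ 2)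
  have : x / R ^ 2 * x = x ^ 2 / R ^ 2 := by ring
  have h5 : (x / R ^ 2) ^ 2 * R ^ 2 / 2 = (x ^ 2 / R ^ 2) / 2 := by field_simp
  have h6 : 2 * L < x ^ 2 / R ^ 2 := by rw [lt_div_iff₀ (by positivity)]; linarith
  linarith

lemma sgnIP_le (n : ℕ) (σ : Fin n → Bool) (v : Fin n → ℝ) (e : ℝ) (he : 0 ≤ e)
    (h : ∑ i, v i ^ 2 ≤ n * e ^ 2) : sgnIP n σ v ≤ n * e := by
  have h1 : (sgnIP n σ v) ^ 2 ≤ n * ∑ i, v i ^ 2 := by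
    have := sq_sum_le_card_mul_sum_sq (s := Finset.univ)
      (f := fun i => (if σ i then (1 : ℝ) else -1) * v i)
    simp only [Finset.card_univ, Fintype.card_fin] at this
    refine this.trans (le_of_eq ?_)
    congr 1
    refine Finset.sum_congr rfl fun i _ => ?_
    split_ifs <;> ring
  refine abs_le_of_sq_le_sq' ?_ (by positivity) |>.2
  calc _ ≤ _ := h1
    _ ≤ n * (n * e ^ 2) := by gcongr
    _ = _ := by ring

theorem dudley_entropy_integral
    {α : Type*} (n : ℕ) (hn : 0 < n)
    (𝓕 : Set (α → ℝ)) (S : Fin n → α)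
    (h𝓕 : ∀ f ∈ 𝓕, ∀ x, f x ∈ Set.Icc (0 : ℝ) 1)
    (h0 : (fun _ => (0 : ℝ)) ∈ 𝓕)
    (p : ℝ≥0∞) (hp : 2 ≤ p) :
    ∀ a : ℝ, 0 < a →
      empRad n 𝓕 S ≤
        4 * a + (12 / Real.sqrt n) *
          ∫ ε in a..1, Real.sqrt (Real.log (empCovN n 𝓕 S p ε)) := by
  intro a ha
  have hn' : (0 : ℝ) < n := by exact_mod_cast hn
  set H : ℝ → ℝ := fun ε => Real.sqrt (Real.log (empCovN n 𝓕 S p ε)) with hH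
  have hH0 : ∀ ε, 0 ≤ H ε := fun ε => Real.sqrt_nonneg _
  have hne := emp_cov_nonempty n hn 𝓕 S h𝓕 p hp
  have hcov : ∀ e : ℝ, 0 < e → ∃ T : Finset (Fin n → ℝ), T.card = empCovN n 𝓕 S p e ∧
      ∀ f ∈ 𝓕, ∃ t ∈ T, empPNorm n p (fun i => f (S i) - t i) ≤ e := fun e he =>
    Nat.sInf_mem (hne e he)
  have hpos : ∀ e : ℝ, 0 < e → 0 < empCovN n 𝓕 S p e := fun e he => by
    obtain ⟨T, hT, hc⟩ := hcov e he
    obtain ⟨t, ht, -⟩ := hc _ h0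
    rw [← hT]; exact Finset.card_pos.2 ⟨t, ht⟩
  have hmono : ∀ e e' : ℝ, 0 < e → e ≤ e' → empCovN n 𝓕 S p e' ≤ empCovN n 𝓕 S p e :=
    fun e e' he hee => by
      obtain ⟨T, hT, hc⟩ := hcov e he
      refine Nat.sInf_le ⟨T, hT, fun f hf => ?_⟩
      obtain ⟨t, ht, h⟩ := hc f hf
      exact ⟨t, ht, h.trans hee⟩
  have hHanti : ∀ e e' : ℝ, 0 < e → e ≤ e' → H e' ≤ H e := fun e e' he hee => by
    refine Real.sqrt_le_sqrt (Real.log_le_log ?_ ?_)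
    · exact_mod_cast hpos e' (he.trans_le hee)
    · exact_mod_cast hmono e e' he hee
  have hint : ∀ x y : ℝ, 0 < x → 0 < y → IntervalIntegrable H MeasureTheory.volume x y :=
    fun x y hx hy => by
      refine AntitoneOn.intervalIntegrable fun u hu v hv huv => hHanti u v ?_ huv
      exact (lt_min hx hy).trans_le hu.1
  have hone : ∀ e : ℝ, 1 ≤ e → H e = 0 := fun e he => by
    have h1 : empCovN n 𝓕 S p e ≤ 1 := by
      refine Nat.sInf_le ⟨{0}, by simp, fun f hf => ⟨0, by simp, ?_⟩⟩
      refine emp_le_of_sup n hn p hp _ _ fun i => ?_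
      have := h𝓕 f hf (S i)
      simp only [Pi.zero_apply, sub_zero]
      rw [abs_of_nonneg this.1]; exact this.2.trans he
    have h2 : empCovN n 𝓕 S p e = 1 := le_antisymm h1 (hpos e (by linarith))
    simp [hH, h2]
  have hI0 : 0 ≤ ∫ ε in a..1, H ε := by
    rcases le_total a 1 with h | h
    · exact intervalIntegral.integral_nonneg h fun u _ => hH0 u
    · rw [intervalIntegral.integral_congr (g := fun _ => 0)]
      · simp
      · intro u hu
        rw [Set.uIcc_of_ge h] at hu
        exact hone u hu.1
  -- near maximizers
  refine le_of_forall_pos_le_add fun δ hδ => ?_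
  have hsel : ∀ σ : Fin n → Bool, ∃ f ∈ 𝓕, sSup ((fun f : α → ℝ =>
      (1 / (n : ℝ)) * ∑ i, (if σ i then (1 : ℝ) else -1) * f (S i)) '' 𝓕)
        ≤ (1 / (n : ℝ)) * sgnIP n σ (fun i => f (S i)) + δ := fun σ => by
    obtain ⟨y, ⟨f, hf, rfl⟩, hy⟩ := exists_lt_of_lt_csSup (Set.Nonempty.image (fun f : α → ℝ =>
      (1 / (n : ℝ)) * ∑ i, (if σ i then (1 : ℝ) else -1) * f (S i)) ⟨_, h0⟩)
      (sub_lt_self _ hδ)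
    exact ⟨f, hf, by simp only [sgnIP]; linarith⟩
  choose F hF hFs using hsel
  have hrad : empRad n 𝓕 S ≤ (1 / (n : ℝ)) * sgnE n (fun σ => sgnIP n σ (fun i => F σ (S i))) + δ := by
    have := sgnE_mono hFs
    rw [sgnE_add, sgnE_const, sgnE_smul] at this
    exact this
  refine hrad.trans (add_le_add_left ?_ _)
  rw [one_div, inv_mul_le_iff₀ hn']
  -- trivial case
  by_cases hab : 1 / 4 ≤ a
  · have h1 : sgnE n (fun σ => sgnIP n σ (fun i => F σ (S i))) ≤ n * 1 := by
      rw [← sgnE_const n (n * 1)]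
      refine sgnE_mono fun σ => sgnIP_le n σ _ 1 zero_le_one ?_
      refine emp_sq_le n hn p hp _ _ (emp_le_of_sup n hn p hp _ _ fun i => ?_)
      have := h𝓕 (F σ) (hF σ) (S i)
      rw [abs_of_nonneg this.1]; exact this.2
    refine h1.trans (mul_le_mul_of_nonneg_left ?_ hn'.le)
    have : 0 ≤ 12 / Real.sqrt n * ∫ ε in a..1, H ε := mul_nonneg (by positivity) hI0
    linarith
  push Not at hab
  -- chain
  set b : ℕ → ℝ := fun j => (1 / 2 : ℝ) ^ j with hb
  have hb0 : ∀ j, 0 < b j := fun j => by positivity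
  have hbs : ∀ j, b j = 2 * b (j + 1) := fun j => by simp only [hb, pow_succ]; ring
  have hTs : ∀ j : ℕ, ∃ T : Finset (Fin n → ℝ), T.card = empCovN n 𝓕 S p (b j) ∧
      (∀ f ∈ 𝓕, ∃ t ∈ T, empPNorm n p (fun i => f (S i) - t i) ≤ b j) ∧ (j = 0 → T = {0}) := by
    intro j
    rcases Nat.eq_zero_or_pos j with rfl | hj
    · have hb1 : b 0 = 1 := by simp [hb]
      refine ⟨{0}, ?_, fun f hf => ⟨0, by simp, ?_⟩, fun _ => rfl⟩
      · have h1 : empCovN n 𝓕 S p (b 0) ≤ 1 := by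
          refine Nat.sInf_le ⟨{0}, by simp, fun f hf => ⟨0, by simp, ?_⟩⟩
          refine emp_le_of_sup n hn p hp _ _ fun i => ?_
          have := h𝓕 f hf (S i)
          simp only [Pi.zero_apply, sub_zero]
          rw [abs_of_nonneg this.1, hb1]; exact this.2
        have := hpos (b 0) (hb0 0)
        simp; omega
      · refine emp_le_of_sup n hn p hp _ _ fun i => ?_
        have := h𝓕 f hf (S i)
        simp only [Pi.zero_apply, sub_zero]
        rw [abs_of_nonneg this.1, hb1]; exact this.2
    · obtain ⟨T, h1, h2⟩ := hcov (b j) (hb0 j)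
      exact ⟨T, h1, h2, fun h => by omega⟩
  choose T hTc hTcov hT0 using hTs
  have hG : ∀ (j : ℕ) (σ : Fin n → Bool), ∃ t ∈ T j,
      empPNorm n p (fun i => F σ (S i) - t i) ≤ b j := fun j σ => hTcov j (F σ) (hF σ)
  choose G hGT hGn using hG
  have hGsq : ∀ j σ, ∑ i, (F σ (S i) - G j σ i) ^ 2 ≤ n * b j ^ 2 := fun j σ =>
    emp_sq_le n hn p hp _ _ (hGn j σ)
  have hstep : ∀ j, sgnE n (fun σ => sgnIP n σ (G (j + 1) σ)) ≤ sgnE n (fun σ => sgnIP n σ (G j σ))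
      + n * (12 / Real.sqrt n * ∫ ε in b (j + 2)..b (j + 1), H ε) := by
    intro j
    have hbj := hb0 (j + 1)
    set A : Finset (Fin n → ℝ) := (Finset.image₂ (fun u w => fun i => u i - w i) (T (j + 1)) (T j)).filter
      (fun v => ∑ i, v i ^ 2 ≤ (3 * b (j + 1) * Real.sqrt n) ^ 2) with hAdef
    have hVA : ∀ σ, (fun i => G (j + 1) σ i - G j σ i) ∈ A := fun σ => by
      rw [hAdef, Finset.mem_filter]
      refine ⟨Finset.mem_image₂_of_mem (f := fun (u w : Fin n → ℝ) => fun i => u i - w i)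
        (hGT (j + 1) σ) (hGT j σ), ?_⟩
      have h1 := hGsq (j + 1) σ
      have h2 := hGsq j σ
      rw [hbs j] at h2
      rw [mul_pow, Real.sq_sqrt hn'.le]
      calc ∑ i, (G (j + 1) σ i - G j σ i) ^ 2
          ≤ ∑ i, (3 * (F σ (S i) - G (j + 1) σ i) ^ 2 + 3 / 2 * (F σ (S i) - G j σ i) ^ 2) := by
            refine Finset.sum_le_sum fun i _ => ?_
            nlinarith [sq_nonneg (2 * (F σ (S i) - G (j + 1) σ i) + (F σ (S i) - G j σ i))]
        _ = 3 * ∑ i, (F σ (S i) - G (j + 1) σ i) ^ 2 + 3 / 2 * ∑ i, (F σ (S i) - G j σ i) ^ 2 := by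
            rw [Finset.sum_add_distrib, Finset.mul_sum, Finset.mul_sum]
        _ ≤ _ := by nlinarith
    have hN1 : 0 < empCovN n 𝓕 S p (b (j + 1)) := hpos _ hbj
    have hlog0 : 0 ≤ Real.log (empCovN n 𝓕 S p (b (j + 1))) := Real.log_natCast_nonneg _
    have hcard : A.card ≤ empCovN n 𝓕 S p (b (j + 1)) ^ 2 := by
      calc A.card ≤ _ := Finset.card_filter_le _ _
        _ ≤ (T (j + 1)).card * (T j).card := Finset.card_image₂_le _ _ _
        _ ≤ _ := by
          rw [hTc, hTc, sq]
          refine Nat.mul_le_mul_left _ (hmono _ _ hbj ?_)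
          rw [hbs j]; linarith
    have hlog : Real.log A.card ≤ 2 * Real.log (empCovN n 𝓕 S p (b (j + 1))) := by
      have h1 : (0 : ℝ) < A.card := by
        exact_mod_cast Finset.card_pos.2 ⟨_, hVA (fun _ => true)⟩
      have h2 : (A.card : ℝ) ≤ (empCovN n 𝓕 S p (b (j + 1)) : ℝ) ^ 2 := by exact_mod_cast hcard
      have := Real.log_le_log h1 h2
      rwa [Real.log_pow, Nat.cast_ofNat] at this
    have hm := massart n A (3 * b (j + 1) * Real.sqrt n) (by positivity)
      (2 * Real.log (empCovN n 𝓕 S p (b (j + 1)))) (fun v hv => (Finset.mem_filter.1 hv).2)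
      (by positivity) hlog (fun σ => fun i => G (j + 1) σ i - G j σ i) hVA
    have hsplit : sgnE n (fun σ => sgnIP n σ (G (j + 1) σ)) = sgnE n (fun σ => sgnIP n σ (G j σ))
        + sgnE n (fun σ => sgnIP n σ (fun i => G (j + 1) σ i - G j σ i)) := by
      rw [← sgnE_add]; congr 1; funext σ; rw [sgnIP_sub]; ring
    rw [hsplit]
    refine add_le_add_right (hm.trans ?_) _
    have hs2 : Real.sqrt (2 * (2 * Real.log (empCovN n 𝓕 S p (b (j + 1))))) = 2 * H (b (j + 1)) := by
      rw [← mul_assoc, Real.sqrt_mul (by norm_num)]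
      congr 1
      rw [show (2 * 2 : ℝ) = 2 ^ 2 by norm_num, Real.sqrt_sq (by norm_num)]
    rw [hs2]
    have hInt : b (j + 2) * H (b (j + 1)) ≤ ∫ ε in b (j + 2)..b (j + 1), H ε := by
      have hle : b (j + 2) ≤ b (j + 1) := by rw [hbs (j + 1)]; linarith [hb0 (j + 2)]
      have := intervalIntegral.integral_mono_on (f := fun _ => H (b (j + 1))) (g := H) hle
        intervalIntegrable_const (hint _ _ (hb0 _) (hb0 _))
        (fun x hx => hHanti x _ ((hb0 _).trans_le hx.1) hx.2)
      rw [intervalIntegral.integral_const, smul_eq_mul] at this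
      have h3 := hbs (j + 1)
      rw [show b (j + 1) - b (j + 2) = b (j + 2) by rw [h3]; ring] at this
      exact this
    have hnd : (n : ℝ) * (12 / Real.sqrt n) = 12 * Real.sqrt n := by
      have : Real.sqrt n ≠ 0 := by positivity
      field_simp
      rw [Real.sq_sqrt hn'.le]
    rw [← mul_assoc (n : ℝ), hnd]
    have hb2 : b (j + 1) = 2 * b (j + 2) := hbs (j + 1)
    calc _ = 12 * Real.sqrt n * (b (j + 2) * H (b (j + 1))) := by
            generalize H (b (j + 1)) = y
            rw [hb2]; ring
      _ ≤ _ := by gcongr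
  have hchain : ∀ j, sgnE n (fun σ => sgnIP n σ (G j σ)) ≤
      n * (12 / Real.sqrt n * ∫ ε in b (j + 1)..1, H ε) := by
    intro j
    induction j with
    | zero =>
      have : ∀ σ, G 0 σ = 0 := fun σ => by
        have := hGT 0 σ
        rwa [hT0 0 rfl, Finset.mem_singleton] at this
      have h1 : sgnE n (fun σ => sgnIP n σ (G 0 σ)) = 0 := by
        simp [this, sgnIP, sgnE]
      rw [h1]
      have : 0 ≤ ∫ ε in b (0 + 1)..1, H ε :=
        intervalIntegral.integral_nonneg (by norm_num [hb]) fun u _ => hH0 u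
      positivity
    | succ j ih =>
      have h1 := hstep j
      have h2 := intervalIntegral.integral_add_adjacent_intervals
        (hint (b (j + 2)) (b (j + 1)) (hb0 _) (hb0 _)) (hint (b (j + 1)) 1 (hb0 _) one_pos)
      show _ ≤ n * (12 / Real.sqrt n * ∫ ε in b (j + 2)..1, H ε)
      rw [← h2, mul_add, mul_add]
      linarith
  -- choose N
  obtain ⟨N, hN1, hN2⟩ : ∃ N, a ≤ b (N + 1) ∧ b N ≤ 4 * a := by
    obtain ⟨m, hm1, hm2⟩ := exists_nat_pow_near_of_lt_one (y := (1 / 2 : ℝ)) (x := 4 * a) (by positivity)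
      (by linarith) (by norm_num) (by norm_num)
    refine ⟨m + 1, ?_, hm1.le⟩
    have h1 := hbs m
    have h2 := hbs (m + 1)
    have : 4 * a ≤ b m := hm2
    show a ≤ b (m + 1 + 1)
    linarith
  have hdec : sgnE n (fun σ => sgnIP n σ (fun i => F σ (S i))) =
      sgnE n (fun σ => sgnIP n σ (G N σ))
        + sgnE n (fun σ => sgnIP n σ (fun i => F σ (S i) - G N σ i)) := by
    rw [← sgnE_add]; congr 1; funext σ; rw [sgnIP_sub]; ring
  have hlast : sgnE n (fun σ => sgnIP n σ (fun i => F σ (S i) - G N σ i)) ≤ n * b N := by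
    rw [← sgnE_const n (n * b N)]
    exact sgnE_mono fun σ => sgnIP_le n σ _ _ (hb0 N).le (hGsq N σ)
  have hII : ∫ ε in b (N + 1)..1, H ε ≤ ∫ ε in a..1, H ε := by
    rw [← intervalIntegral.integral_add_adjacent_intervals
        (hint a (b (N + 1)) ha (hb0 _)) (hint (b (N + 1)) 1 (hb0 _) one_pos)]
    have := intervalIntegral.integral_nonneg (μ := MeasureTheory.volume) hN1 fun u _ => hH0 u
    linarith
  rw [hdec, mul_add, add_comm]
  refine add_le_add (hlast.trans (by gcongr)) ((hchain N).trans ?_)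
  gcongr
end
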